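/- arXiv:1410.0609 — 3 statements merged into one kernel-verified Lean document; each statement's English description precedes it below -/
import Mathlib

section
/- There exists a smooth function χ: (0,1) × (1,∞) × ℝ → ℝ_{≥0} such that: (a) χ(δ,s,r) = s whenever r ≤ δ; (b) χ(δ,s,r) = 0 whenever r ≥ δ·e^{4s/δ}; (c) χ(δ,s,r) ≤ s for all inputs; and (d) |∂χ/∂r(δ,s,r)|·r ≤ δ for all inputs. -/
open Set

namespace Real

/-- On the open unit interval the smooth transition function is a logistic function of
`x⁻¹ - (1 - x)⁻¹`. -/
theorem smoothTransition_eq_of_mem_Ioo {x : ℝ} (hx : x ∈ Ioo (0 : ℝ) 1) :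
    smoothTransition x = (1 + exp (x⁻¹ - (1 - x)⁻¹))⁻¹ := by
  have h₀ : ¬ x ≤ 0 := not_le.2 hx.1
  have h₁ : ¬ 1 - x ≤ 0 := by linarith [hx.2]
  have h : exp (-(1 - x)⁻¹) = exp (-x⁻¹) * exp (x⁻¹ - (1 - x)⁻¹) := by
    rw [← exp_add]
    congr 1
    ring
  rw [smoothTransition, expNegInvGlue, expNegInvGlue, if_neg h₀, if_neg h₁, h]
  have := exp_pos (-x⁻¹)
  have := exp_pos (x⁻¹ - (1 - x)⁻¹)
  field_simp

theorem four_add_sq_le_two_add_exp_add_exp_neg (x : ℝ) : 4 + x ^ 2 ≤ 2 + exp x + exp (-x) := by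
  have hsq : (x / 2) ^ 2 ≤ sinh (x / 2) ^ 2 := by
    rcases le_total 0 (x / 2) with h | h
    · nlinarith [self_le_sinh_iff.2 h]
    · nlinarith [sinh_le_self_iff.2 h]
  have hcosh : cosh x = 1 + 2 * sinh (x / 2) ^ 2 := by
    rw [← mul_div_cancel₀ x (two_ne_zero' ℝ), mul_div_assoc, cosh_two_mul, cosh_sq]
    ring_nf
  rw [cosh_eq] at hcosh
  linarith

/-- The derivative of the smooth transition function is bounded by `2`. -/
theorem abs_deriv_smoothTransition_le_two (x : ℝ) : |deriv smoothTransition x| ≤ 2 := by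
  rcases le_or_gt x 0 with h₀ | h₀
  · have hmin : IsLocalMin smoothTransition x := Filter.Eventually.of_forall fun y => by
      rw [smoothTransition.zero_of_nonpos h₀]
      exact smoothTransition.nonneg y
    simp [hmin.deriv_eq_zero]
  rcases le_or_gt 1 x with h₁ | h₁
  · have hmax : IsLocalMax smoothTransition x := Filter.Eventually.of_forall fun y => by
      rw [smoothTransition.one_of_one_le h₁]
      exact smoothTransition.le_one y
    simp [hmax.deriv_eq_zero]
  have hx' : 0 < 1 - x := by linarith
  have heq : smoothTransition =ᶠ[nhds x] fun y => (1 + exp (y⁻¹ - (1 - y)⁻¹))⁻¹ := by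
    filter_upwards [Ioo_mem_nhds h₀ h₁] with y hy using smoothTransition_eq_of_mem_Ioo hy
  have hE := exp_pos (x⁻¹ - (1 - x)⁻¹)
  have hder := (((((hasDerivAt_id x).inv h₀.ne').sub
    (((hasDerivAt_id x).const_sub 1).inv hx'.ne')).exp).const_add 1).inv
      (by simp only [id, Pi.sub_apply, Pi.inv_apply]; positivity)
  rw [heq.deriv_eq]
  refine (congrArg abs hder.deriv).trans_le ?_
  simp only [id, Pi.sub_apply, Pi.inv_apply]
  set h := x⁻¹ - (1 - x)⁻¹ with hh
  have hcosh := four_add_sq_le_two_add_exp_add_exp_neg h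
  have hp : 4 ≤ x⁻¹ * (1 - x)⁻¹ := by
    rw [← mul_inv, le_inv_comm₀ (by norm_num) (by positivity)]
    nlinarith [sq_nonneg (2 * x - 1)]
  have hsum : x⁻¹ + (1 - x)⁻¹ = x⁻¹ * (1 - x)⁻¹ := by
    field_simp
    ring
  have hslope : (x⁻¹) ^ 2 + ((1 - x)⁻¹) ^ 2 ≤ 2 * (4 + h ^ 2) := by
    have h1 : (x⁻¹) ^ 2 + ((1 - x)⁻¹) ^ 2 =
        (x⁻¹ * (1 - x)⁻¹) ^ 2 - 2 * (x⁻¹ * (1 - x)⁻¹) := by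
      rw [← hsum]
      nlinarith
    have h2 : h ^ 2 = (x⁻¹) ^ 2 + ((1 - x)⁻¹) ^ 2 - 2 * (x⁻¹ * (1 - x)⁻¹) := by
      rw [hh]
      ring
    rw [h2, h1]
    nlinarith
  have hval : -(exp h * (-1 / x ^ 2 - -(-1) / (1 - x) ^ 2)) / (1 + exp h) ^ 2 =
      ((x⁻¹) ^ 2 + ((1 - x)⁻¹) ^ 2) / (2 + exp h + exp (-h)) := by
    rw [exp_neg]
    field_simp
    ring
  rw [hval, abs_of_nonneg (by positivity), div_le_iff₀ (by positivity)]
  linarith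

end Real

/-- A cutoff of height `s`: it equals `s` for `r ≤ δ`, and then decreases to `0` as a smooth step
function of `log r`. -/
noncomputable def logCutoff (δ s r : ℝ) : ℝ :=
  if r ≤ δ then s else s * (1 - Real.smoothTransition (δ / (4 * s) * Real.log (r / δ)))

section logCutoff

variable {δ s r : ℝ}

theorem logCutoff_of_le (h : r ≤ δ) : logCutoff δ s r = s := if_pos h

theorem logCutoff_of_pos (hδ : 0 < δ) (hs : 0 < s) (hr : 0 < r) :
    logCutoff δ s r = s * (1 - Real.smoothTransition (δ / (4 * s) * Real.log (r / δ))) := by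
  unfold logCutoff
  split_ifs with h
  · have hlog : Real.log (r / δ) ≤ 0 :=
      Real.log_nonpos (by positivity) ((div_le_one hδ).2 h)
    rw [Real.smoothTransition.zero_of_nonpos
      (mul_nonpos_of_nonneg_of_nonpos (by positivity) hlog)]
    ring
  · rfl

theorem logCutoff_nonneg (hs : 0 < s) : 0 ≤ logCutoff δ s r := by
  unfold logCutoff
  split_ifs
  · exact hs.le
  · exact mul_nonneg hs.le (sub_nonneg.2 (Real.smoothTransition.le_one _))

theorem logCutoff_le (hs : 0 < s) : logCutoff δ s r ≤ s := by
  unfold logCutoff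
  split_ifs
  · exact le_rfl
  · exact mul_le_of_le_one_right hs.le (sub_le_self _ (Real.smoothTransition.nonneg _))

theorem logCutoff_eq_zero (hδ : 0 < δ) (hs : 0 < s) (hr : δ * Real.exp (4 * s / δ) ≤ r) :
    logCutoff δ s r = 0 := by
  have hr₀ : 0 < r := lt_of_lt_of_le (by positivity) hr
  have hlog : 4 * s / δ ≤ Real.log (r / δ) := by
    rw [Real.le_log_iff_exp_le (by positivity), le_div_iff₀ hδ]
    linarith
  have hone : 1 ≤ δ / (4 * s) * Real.log (r / δ) :=
    calc 1 = δ / (4 * s) * (4 * s / δ) := by field_simp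
      _ ≤ _ := by gcongr
  rw [logCutoff_of_pos hδ hs hr₀, Real.smoothTransition.one_of_one_le hone]
  ring

theorem abs_deriv_logCutoff_mul_le (hδ : 0 < δ) (hs : 0 < s) :
    |deriv (logCutoff δ s) r| * r ≤ δ := by
  rcases le_or_gt r 0 with hr | hr
  · exact (mul_nonpos_of_nonneg_of_nonpos (abs_nonneg _) hr).trans hδ.le
  have heq : logCutoff δ s =ᶠ[nhds r]
      fun t => s * (1 - Real.smoothTransition (δ / (4 * s) * Real.log (t / δ))) := by
    filter_upwards [Ioi_mem_nhds hr] with t ht using logCutoff_of_pos hδ hs ht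
  have hinner : HasDerivAt (fun t => δ / (4 * s) * Real.log (t / δ))
      (δ / (4 * s) * (1 / δ / (r / δ))) r :=
    (((hasDerivAt_id r).div_const δ).log (div_pos hr hδ).ne').const_mul _
  have hstep : HasDerivAt Real.smoothTransition
      (deriv Real.smoothTransition (δ / (4 * s) * Real.log (r / δ)))
      (δ / (4 * s) * Real.log (r / δ)) :=
    (Real.smoothTransition.contDiff (n := 1).differentiable (by norm_num) _).hasDerivAt
  have hder := ((hstep.comp r hinner).const_sub 1).const_mul s
  rw [heq.deriv_eq]
  have hbound := Real.abs_deriv_smoothTransition_le_two (δ / (4 * s) * Real.log (r / δ))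
  have hval := hder.deriv
  simp only [Function.comp_def] at hval
  rw [hval]
  set D := deriv Real.smoothTransition (δ / (4 * s) * Real.log (r / δ))
  have hsimp : s * -(D * (δ / (4 * s) * (1 / δ / (r / δ)))) = -(D * (δ / (4 * r))) := by
    field_simp
  rw [hsimp, abs_neg, abs_mul, abs_of_pos (a := δ / (4 * r)) (by positivity)]
  calc |D| * (δ / (4 * r)) * r = |D| * (δ / 4) := by field_simp
    _ ≤ 2 * (δ / 4) := by gcongr
    _ ≤ δ := by linarith

theorem contDiffAt_logCutoff {n : ℕ∞} (hδ : 0 < δ) (hs : 0 < s) :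
    ContDiffAt ℝ n (fun p : ℝ × ℝ × ℝ => logCutoff p.1 p.2.1 p.2.2) (δ, s, r) := by
  rcases lt_or_ge r δ with hr | hr
  · have heq : (fun p : ℝ × ℝ × ℝ => logCutoff p.1 p.2.1 p.2.2) =ᶠ[nhds (δ, s, r)]
        fun p => p.2.1 := by
      have hopen : IsOpen {p : ℝ × ℝ × ℝ | p.2.2 < p.1} :=
        isOpen_lt (by fun_prop) (by fun_prop)
      filter_upwards [hopen.mem_nhds hr] with p hp using logCutoff_of_le (le_of_lt hp)
    exact ContDiffAt.congr_of_eventuallyEq (by fun_prop) heq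
  · have hr₀ : 0 < r := hδ.trans_le hr
    have heq : (fun p : ℝ × ℝ × ℝ => logCutoff p.1 p.2.1 p.2.2) =ᶠ[nhds (δ, s, r)]
        fun p => p.2.1 *
          (1 - Real.smoothTransition (p.1 / (4 * p.2.1) * Real.log (p.2.2 / p.1))) := by
      have hmem : Ioi (0 : ℝ) ×ˢ Ioi (0 : ℝ) ×ˢ Ioi (0 : ℝ) ∈ nhds (δ, s, r) :=
        prod_mem_nhds (Ioi_mem_nhds hδ) (prod_mem_nhds (Ioi_mem_nhds hs) (Ioi_mem_nhds hr₀))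
      filter_upwards [hmem] with p hp using logCutoff_of_pos hp.1 hp.2.1 hp.2.2
    refine ContDiffAt.congr_of_eventuallyEq ?_ heq
    have hinner : ContDiffAt ℝ n
        (fun p : ℝ × ℝ × ℝ => p.1 / (4 * p.2.1) * Real.log (p.2.2 / p.1)) (δ, s, r) := by
      refine ContDiffAt.mul (ContDiffAt.div (by fun_prop) (by fun_prop) (by positivity)) ?_
      exact ContDiffAt.log (ContDiffAt.div (by fun_prop) (by fun_prop) hδ.ne')
        (div_pos hr₀ hδ).ne'
    exact ContDiffAt.mul (by fun_prop)
      (contDiffAt_const.sub (Real.smoothTransition.contDiffAt.comp _ hinner))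

end logCutoff

/-- existence of a smooth cutoff function `χ : (0,1) × (1,∞) × ℝ → ℝ≥0`
with the properties of Lemma 3.9 of the paper. -/
theorem stmt3 :
    ∃ χ : ℝ → ℝ → ℝ → ℝ,
      ContDiffOn ℝ (⊤ : ℕ∞) (fun p : ℝ × ℝ × ℝ => χ p.1 p.2.1 p.2.2)
        (Ioo (0 : ℝ) 1 ×ˢ Ioi (1 : ℝ) ×ˢ (univ : Set ℝ)) ∧
      ∀ δ ∈ Ioo (0 : ℝ) 1, ∀ s ∈ Ioi (1 : ℝ),
        (∀ r : ℝ, 0 ≤ χ δ s r) ∧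
        (∀ r : ℝ, r ≤ δ → χ δ s r = s) ∧
        (∀ r : ℝ, δ * Real.exp (4 * s / δ) ≤ r → χ δ s r = 0) ∧
        (∀ r : ℝ, χ δ s r ≤ s) ∧
        (∀ r : ℝ, |deriv (χ δ s) r| * r ≤ δ) := by
  refine ⟨logCutoff, ?_, fun δ hδ s hs => ?_⟩
  · rintro ⟨δ, s, r⟩ ⟨hδ, hs, -⟩
    exact (contDiffAt_logCutoff hδ.1 (zero_lt_one.trans hs)).contDiffWithinAt
  · have hs₀ : 0 < s := zero_lt_one.trans hs
    exact ⟨fun _ => logCutoff_nonneg hs₀, fun _ => logCutoff_of_le,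
      fun _ => logCutoff_eq_zero hδ.1 hs₀, fun _ => logCutoff_le hs₀,
      fun _ => abs_deriv_logCutoff_mul_le hδ.1 hs₀⟩
end

section
/- Let V be a smooth manifold, I = {1,...,ℓ*} a finite index set with ℓ* ≥ 2, and L_i → V smooth real vector bundles. Set 𝒩 = ⊕_{i∈I} L_i and 𝒩_i = ⊕_{j≠i} L_j. Fix k ≥ 0. Suppose (α_i)_{i∈I} is a tuple where each α_i is a fiberwise alternating k-tensor on 𝒩_i over a point x ∈ V, satisfying the compatibility α_{i₁}|_{𝒩_{i₁}∩𝒩_{i₂}} = α_{i₂}|_{𝒩_{i₁}∩𝒩_{i₂}} for all i₁,i₂ ∈ I. Then there exists an alternating k-tensor α on the fiber 𝒩|_x such that α restricted (via the projection-free inclusion) to each 𝒩_i|_x equals α_i, and the assignment (α_i)_{i∈I} ↦ α can be chosen to be a linear bundle map (a right inverse to the restriction map). -/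
/-- For `𝒩 = ⊕_j W_j`, the subspace `𝒩_i = ⊕_{j ≠ i} W_j` of tuples whose `i`-th
component vanishes. -/
def Nsub {ℓ : ℕ} (W : Fin ℓ → Type*) [∀ i, AddCommGroup (W i)] [∀ i, Module ℝ (W i)]
    (i : Fin ℓ) : Submodule ℝ (∀ j, W j) :=
  LinearMap.ker (LinearMap.proj i : (∀ j, W j) →ₗ[ℝ] W i)

/-- Pullback of alternating maps along a fixed linear map, as a linear map. -/
def AlternatingMap.pullback {R M M' N κ : Type*} [CommRing R] [AddCommGroup M] [Module R M]
    [AddCommGroup M'] [Module R M'] [AddCommGroup N] [Module R N] (f : M →ₗ[R] M') :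
    AlternatingMap R M' N κ →ₗ[R] AlternatingMap R M N κ where
  toFun α := α.compLinearMap f
  map_add' _ _ := rfl
  map_smul' _ _ := rfl

/-- Compatible alternating maps on finitely many submodules, each equipped with a projection
preserving all the others, have a common extension depending linearly on the family. -/
theorem AlternatingMap.exists_linear_extension {R M N κ ι : Type*} [CommRing R]
    [AddCommGroup M] [Module R M] [AddCommGroup N] [Module R N]
    (p : ι → Submodule R M) (π : ∀ i, M →ₗ[R] p i)
    (hπ : ∀ i (x : p i), π i x = x) (hπp : ∀ i j, ∀ x ∈ p j, (π i x : M) ∈ p j)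
    (s : Finset ι) :
    ∃ Φ : (∀ i, AlternatingMap R (p i) N κ) →ₗ[R] AlternatingMap R M N κ,
      ∀ α : ∀ i, AlternatingMap R (p i) N κ,
        (∀ i j, (α i).compLinearMap (Submodule.inclusion (inf_le_left : p i ⊓ p j ≤ p i)) =
          (α j).compLinearMap (Submodule.inclusion (inf_le_right : p i ⊓ p j ≤ p j))) →
        ∀ i ∈ s, (Φ α).compLinearMap (p i).subtype = α i := by
  classical
  induction s using Finset.induction_on with
  | empty => exact ⟨0, by simp⟩
  | insert a s _ ih =>
    obtain ⟨Φ, hΦ⟩ := ih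
    refine ⟨Φ + pullback (π a) ∘ₗ (LinearMap.proj a - pullback (p a).subtype ∘ₗ Φ),
      fun α hα i hi => ?_⟩
    ext v
    change Φ α (fun t => (v t : M)) + (α a (fun t => π a (v t)) -
      Φ α (fun t => (π a (v t) : M))) = α i v
    by_cases hia : i = a
    · subst hia
      simp only [hπ]
      abel
    · have his : i ∈ s := (Finset.mem_insert.mp hi).resolve_left hia
      have extends_i : ∀ w : κ → p i, Φ α (fun t => (w t : M)) = α i w := fun w =>
        DFunLike.congr_fun (hΦ α hα i his) w
      have compat : α i (fun t => ⟨π a (v t), hπp a i _ (v t).2⟩) = α a (fun t => π a (v t)) :=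
        DFunLike.congr_fun (hα i a)
          (fun t => (⟨π a (v t), hπp a i _ (v t).2, (π a (v t)).2⟩ : ↥(p i ⊓ p a)))
      rw [extends_i v, ← compat, ← extends_i fun t => ⟨π a (v t), hπp a i _ (v t).2⟩,
        sub_self, add_zero]

/-- The projection of `⊕_j W_j` onto `Nsub W i` that kills the `i`-th component. -/
def Nsub.projection {ℓ : ℕ} (W : Fin ℓ → Type*) [∀ i, AddCommGroup (W i)]
    [∀ i, Module ℝ (W i)] (i : Fin ℓ) : (∀ j, W j) →ₗ[ℝ] Nsub W i :=
  (LinearMap.id - LinearMap.single ℝ W i ∘ₗ LinearMap.proj i).codRestrict (Nsub W i)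
    fun x => by simp [Nsub]

theorem Nsub.coe_projection {ℓ : ℕ} (W : Fin ℓ → Type*) [∀ i, AddCommGroup (W i)]
    [∀ i, Module ℝ (W i)] (i : Fin ℓ) (x : ∀ j, W j) :
    (Nsub.projection W i x : ∀ j, W j) = x - Pi.single i (x i) := rfl

/-- fiberwise version of Lemma 3.8: given alternating `k`-tensors `α_i` on
the subspaces `𝒩_i = ⊕_{j≠i} W_j` of `𝒩 = ⊕_j W_j` that agree on all pairwise
intersections, there is an alternating `k`-tensor `α` on `𝒩` restricting to each `α_i`,
and the assignment `(α_i) ↦ α` can be chosen linear (a right inverse to restriction). -/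
theorem stmt5 (k ℓ : ℕ) (hℓ : 2 ≤ ℓ)
    (W : Fin ℓ → Type*) [∀ i, AddCommGroup (W i)] [∀ i, Module ℝ (W i)] :
    ∃ Φ : (∀ i, AlternatingMap ℝ (Nsub W i) ℝ (Fin k)) →ₗ[ℝ]
        AlternatingMap ℝ (∀ j, W j) ℝ (Fin k),
      ∀ α : ∀ i, AlternatingMap ℝ (Nsub W i) ℝ (Fin k),
        (∀ i₁ i₂ : Fin ℓ,
          (α i₁).compLinearMap
            (Submodule.inclusion (inf_le_left : Nsub W i₁ ⊓ Nsub W i₂ ≤ Nsub W i₁)) =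
          (α i₂).compLinearMap
            (Submodule.inclusion (inf_le_right : Nsub W i₁ ⊓ Nsub W i₂ ≤ Nsub W i₂))) →
        ∀ i, (Φ α).compLinearMap (Nsub W i).subtype = α i := by
  obtain ⟨Φ, hΦ⟩ := AlternatingMap.exists_linear_extension (N := ℝ) (κ := Fin k)
    (Nsub W) (Nsub.projection W)
    (fun i x => by
      have hx : (x : ∀ j, W j) i = 0 := x.2
      ext1
      rw [Nsub.coe_projection, hx, Pi.single_zero, sub_zero])
    (fun i j x hx => by
      have hx : x j = 0 := hx
      change (Nsub.projection W i x : ∀ j, W j) j = 0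
      rw [Nsub.coe_projection]
      by_cases h : j = i
      · subst h
        simp
      · simp [hx, h])
    Finset.univ
  exact ⟨Φ, fun α hα i => hΦ α hα i (Finset.mem_univ i)⟩
end

section
/- Let Ω be a nondegenerate alternating 2-form on ℝ^{2n} = ℂ^n such that Ω restricted to every coordinate complex subspace ℂ^n_I is nondegenerate with orientation agreeing with the complex orientation, and let i ∉ I with I ⊆ {1,...,n}. Let W = (ℂ^n_{I∪{i}})^Ω ∩ ℂ^n_I be the Ω-orthogonal complement of ℂ^n_{I∪{i}} inside ℂ^n_I. Then W is a 2-dimensional subspace on which the restriction of dx_i∧dy_i is nondegenerate (i.e. W projects isomorphically onto the i-th coordinate ℂ-line), and the Ω-orientation of W agrees with the orientation induced by dx_i∧dy_i|_W. -/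
set_option synthInstance.maxHeartbeats 1000000
set_option maxHeartbeats 1000000

/-- The value of the `m`-th wedge power of a bilinear 2-form `B` on a `2m`-tuple of
vectors (up to the usual positive combinatorial constant).  Its sign on an ordered basis
of a `2m`-dimensional subspace detects the orientation induced by `B`. -/
noncomputable def formPow {V : Type*} [AddCommGroup V] [Module ℝ V]
    (B : V → V → ℝ) (m : ℕ) (v : Fin (2 * m) → V) : ℝ :=
  ∑ σ : Equiv.Perm (Fin (2 * m)),
    ((Equiv.Perm.sign σ : ℤ) : ℝ) *
      ∏ l : Fin m,
        B (v (σ ⟨2 * (l : ℕ), by have := l.isLt; omega⟩))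
          (v (σ ⟨2 * (l : ℕ) + 1, by have := l.isLt; omega⟩))

/-- The coordinate subspace `ℂ^n_I = {z : z_i = 0 ∀ i ∈ I}`, as a real subspace. -/
noncomputable def coordSubspace (n : ℕ) (I : Finset (Fin n)) : Submodule ℝ (Fin n → ℂ) where
  carrier := {z | ∀ i ∈ I, z i = 0}
  add_mem' := by intro a b ha hb i hi; simp [ha i hi, hb i hi]
  zero_mem' := by intro i _; rfl
  smul_mem' := by intro c a ha i hi; simp [ha i hi]

/-- The standard, complex-positively-oriented, real basis
`(e_{j₁}, i·e_{j₁}, …, e_{j_m}, i·e_{j_m})` of the coordinate subspace `ℂ^n_I`,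
where `j₁ < ⋯ < j_m` enumerate the complement of `I`. -/
noncomputable def stdTuple (n : ℕ) (I : Finset (Fin n)) :
    Fin (2 * (n - I.card)) → (Fin n → ℂ) := fun j =>
  let e := Iᶜ.orderIsoOfFin (by simp [Finset.card_compl])
  let b : Fin (n - I.card) := ⟨(j : ℕ) / 2, by have := j.isLt; omega⟩
  if (j : ℕ) % 2 = 0 then Pi.single (e b : Fin n) 1 else Pi.single (e b : Fin n) Complex.I

/-- Nondegeneracy of a bilinear form on a subspace. -/
def NondegOn {V : Type*} [AddCommGroup V] [Module ℝ V]
    (B : V → V → ℝ) (W : Submodule ℝ V) : Prop :=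
  ∀ v ∈ W, (∀ w ∈ W, B v w = 0) → v = 0

/-- The symplectic orthogonal complement `U^Ω`. -/
def sympCompl {V : Type*} [AddCommGroup V] [Module ℝ V]
    (ω : V →ₗ[ℝ] V →ₗ[ℝ] ℝ) (W : Submodule ℝ V) : Submodule ℝ V where
  carrier := {v | ∀ w ∈ W, ω v w = 0}
  add_mem' := by
    intro a b ha hb w hw
    simp [map_add, LinearMap.add_apply, ha w hw, hb w hw]
  zero_mem' := by intro w _; simp
  smul_mem' := by
    intro c a ha w hw
    simp [map_smul, LinearMap.smul_apply, ha w hw]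

/-- The standard area form `dx_i ∧ dy_i` in the `i`-th complex coordinate of `ℂ^n`. -/
noncomputable def areaForm (n : ℕ) (i : Fin n) :
    (Fin n → ℂ) →ₗ[ℝ] (Fin n → ℂ) →ₗ[ℝ] ℝ :=
  LinearMap.mk₂ ℝ (fun v w => (v i).re * (w i).im - (v i).im * (w i).re)
    (by intro a b c; simp; ring)
    (by intro r a c; simp [Complex.smul_re, Complex.smul_im]; ring)
    (by intro a b c; simp; ring)
    (by intro r a c; simp [Complex.smul_re, Complex.smul_im]; ring)

theorem AlternatingMap.map_update_eq_zero_of_mem_span {V κ : Type*} [AddCommGroup V]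
    [Module ℝ V] [DecidableEq κ] (f : V [⋀^κ]→ₗ[ℝ] ℝ) (v : κ → V) (j : κ) {u : V}
    (hu : u ∈ Submodule.span ℝ (v '' {j}ᶜ)) : f (Function.update v j u) = 0 := by
  induction hu using Submodule.span_induction with
  | mem x hx =>
    obtain ⟨k, hk, rfl⟩ := hx
    exact f.map_update_self v (Ne.symm hk)
  | zero => exact f.map_update_zero v j
  | add x y _ _ hx hy => rw [f.map_update_add, hx, hy, add_zero]
  | smul c x _ hx => rw [f.map_update_smul, hx, smul_zero]

section WedgePow

variable {V ι κ : Type*} [AddCommGroup V] [Module ℝ V]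
  [Fintype ι] [DecidableEq ι] [Fintype κ] [DecidableEq κ]

theorem prod_pairs_update (B : V →ₗ[ℝ] V →ₗ[ℝ] ℝ) (v : ι × Fin 2 → V) (l : ι) (s : Fin 2)
    (z : V) :
    ∏ k, B (Function.update v (l, s) z (k, 0)) (Function.update v (l, s) z (k, 1)) =
      B (Function.update v (l, s) z (l, 0)) (Function.update v (l, s) z (l, 1)) *
        ∏ k ∈ {l}ᶜ, B (v (k, 0)) (v (k, 1)) := by
  rw [Fintype.prod_eq_mul_prod_compl l]
  congr 1
  refine Finset.prod_congr rfl fun k hk => ?_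
  have hk : k ≠ l := by simpa using hk
  simp [Function.update, hk]

/-- The product of the values of `B` on the pairs `(v (l, 0), v (l, 1))`. -/
noncomputable def pairProd (ι : Type*) [Fintype ι] [DecidableEq ι] (B : V →ₗ[ℝ] V →ₗ[ℝ] ℝ) :
    MultilinearMap ℝ (fun _ : ι × Fin 2 => V) ℝ :=
  MultilinearMap.mk' (fun v => ∏ l, B (v (l, 0)) (v (l, 1)))
    (by
      rintro v ⟨l, s⟩ x y
      simp only [prod_pairs_update]
      fin_cases s <;> simp [Function.update, add_mul])
    (by
      rintro v ⟨l, s⟩ c x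
      simp only [prod_pairs_update]
      fin_cases s <;> simp [Function.update, mul_assoc])

/-- The wedge power of `B` as an alternating map on families indexed by `ι × Fin 2`. -/
noncomputable def wedgePow (ι : Type*) [Fintype ι] [DecidableEq ι] (B : V →ₗ[ℝ] V →ₗ[ℝ] ℝ) :
    V [⋀^ι × Fin 2]→ₗ[ℝ] ℝ :=
  MultilinearMap.alternatization (pairProd ι B)

/-- The contribution of the permutation `σ` to the wedge power of `B`. -/
noncomputable def wedgeTerm (B : V →ₗ[ℝ] V →ₗ[ℝ] ℝ) (v : ι × Fin 2 → V)
    (σ : Equiv.Perm (ι × Fin 2)) : ℝ :=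
  ((Equiv.Perm.sign σ : ℤ) : ℝ) * ∏ l, B (v (σ (l, 0))) (v (σ (l, 1)))

theorem wedgePow_apply (B : V →ₗ[ℝ] V →ₗ[ℝ] ℝ) (v : ι × Fin 2 → V) :
    wedgePow ι B v = ∑ σ, wedgeTerm B v σ := by
  simp only [wedgePow, MultilinearMap.alternatization_apply, wedgeTerm]
  refine Finset.sum_congr rfl fun σ _ => ?_
  rw [Units.smul_def, zsmul_eq_mul]
  rfl

theorem wedgePow_reindex (B : V →ₗ[ℝ] V →ₗ[ℝ] ℝ) (e : ι ≃ κ) (v : κ × Fin 2 → V) :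
    wedgePow ι B (fun x => v (e x.1, x.2)) = wedgePow κ B v := by
  rw [wedgePow_apply, wedgePow_apply]
  refine Fintype.sum_equiv (e.prodCongr (Equiv.refl (Fin 2))).permCongr _ _ fun σ => ?_
  simp only [wedgeTerm, Equiv.Perm.sign_permCongr]
  congr 1
  refine Fintype.prod_equiv e _ _ fun l => ?_
  simp [Equiv.permCongr_apply, Prod.map]

theorem wedgeTerm_mul_blockPerm (B : V →ₗ[ℝ] V →ₗ[ℝ] ℝ) (v : ι × Fin 2 → V)
    (σ : Equiv.Perm (ι × Fin 2)) (π : Equiv.Perm ι) :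
    wedgeTerm B v (σ * Equiv.prodCongrLeft fun _ : Fin 2 => π) = wedgeTerm B v σ := by
  have hs : Equiv.Perm.sign (Equiv.prodCongrLeft fun _ : Fin 2 => π) = 1 := by
    rw [Equiv.Perm.sign_prodCongrLeft]
    simp
  simp only [wedgeTerm, Equiv.Perm.sign_mul, hs, mul_one]
  congr 1
  refine Fintype.prod_equiv π _ _ fun l => ?_
  simp

theorem wedgeTerm_mul_pairSwap (B : V →ₗ[ℝ] V →ₗ[ℝ] ℝ) (hB : B.IsAlt) (v : ι × Fin 2 → V)
    (σ : Equiv.Perm (ι × Fin 2)) (l : ι) :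
    wedgeTerm B v (σ * Equiv.swap (l, 0) (l, 1)) = wedgeTerm B v σ := by
  have hne : ∏ k ∈ {l}ᶜ, B (v (σ (Equiv.swap (l, 0) (l, 1) (k, 0))))
      (v (σ (Equiv.swap (l, 0) (l, 1) (k, 1)))) =
      ∏ k ∈ {l}ᶜ, B (v (σ (k, 0))) (v (σ (k, 1))) := by
    refine Finset.prod_congr rfl fun k hk => ?_
    have hk : k ≠ l := by simpa using hk
    simp [Equiv.swap_apply_def, hk]
  simp only [wedgeTerm, Fintype.prod_eq_mul_prod_compl l, Equiv.Perm.mul_apply, hne]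
  simp [Equiv.Perm.sign_mul, ← hB.neg (v (σ (l, 0)))]

theorem exists_perm_wedgeTerm_mul (B : V →ₗ[ℝ] V →ₗ[ℝ] ℝ) (hB : B.IsAlt) (v : ι × Fin 2 → V)
    (a : ι) (p : ι × Fin 2) :
    ∃ g : Equiv.Perm (ι × Fin 2), g (a, 0) = p ∧
      ∀ σ, wedgeTerm B v (σ * g) = wedgeTerm B v σ := by
  obtain ⟨l, s⟩ := p
  fin_cases s
  · exact ⟨Equiv.prodCongrLeft fun _ => Equiv.swap a l, by simp,
      fun σ => wedgeTerm_mul_blockPerm B v σ _⟩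
  · refine ⟨Equiv.swap (l, 0) (l, 1) * Equiv.prodCongrLeft fun _ => Equiv.swap a l, by simp,
      fun σ => ?_⟩
    rw [← mul_assoc, wedgeTerm_mul_blockPerm, wedgeTerm_mul_pairSwap B hB]

theorem wedgePow_eq_card_mul_sum_fixing (B : V →ₗ[ℝ] V →ₗ[ℝ] ℝ) (hB : B.IsAlt)
    (v : ι × Fin 2 → V) (a : ι) :
    wedgePow ι B v = Fintype.card (ι × Fin 2) *
      ∑ σ : Equiv.Perm (ι × Fin 2), if σ (a, 0) = (a, 0) then wedgeTerm B v σ else 0 := by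
  have hfib : ∀ p, (∑ σ : Equiv.Perm (ι × Fin 2), if σ p = (a, 0) then wedgeTerm B v σ else 0) =
      ∑ σ : Equiv.Perm (ι × Fin 2), if σ (a, 0) = (a, 0) then wedgeTerm B v σ else 0 := by
    intro p
    obtain ⟨g, hg, hinv⟩ := exists_perm_wedgeTerm_mul B hB v a p
    refine Fintype.sum_equiv (Equiv.mulRight g) _ _ fun σ => ?_
    simp [hg, hinv]
  calc wedgePow ι B v = ∑ σ : Equiv.Perm (ι × Fin 2), ∑ p,
        if σ p = (a, 0) then wedgeTerm B v σ else 0 := by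
        rw [wedgePow_apply]
        refine Finset.sum_congr rfl fun σ _ => ?_
        simp [← Equiv.eq_symm_apply]
    _ = _ := by
        rw [Finset.sum_comm, Finset.sum_congr rfl fun p _ => hfib p]
        simp

/-- The pairs other than the distinguished one. -/
def someProdEquiv (ι : Type*) : ι × Fin 2 ≃ {x : Option ι × Fin 2 // x.1 ≠ none} where
  toFun x := ⟨(some x.1, x.2), by simp⟩
  invFun x := (x.1.1.get (Option.isSome_iff_ne_none.2 x.2), x.1.2)
  left_inv x := by simp
  right_inv x := by ext <;> simp

theorem wedgePow_option_of_orthogonal (B : V →ₗ[ℝ] V →ₗ[ℝ] ℝ) (hB : B.IsAlt)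
    (v : Option ι × Fin 2 → V) (horth : ∀ x : ι × Fin 2, B (v (none, 0)) (v (some x.1, x.2)) = 0) :
    wedgePow (Option ι) B v = Fintype.card (Option ι × Fin 2) *
      (B (v (none, 0)) (v (none, 1)) * wedgePow ι B fun x => v (some x.1, x.2)) := by
  rw [wedgePow_eq_card_mul_sum_fixing B hB v none]
  congr 1
  rw [wedgePow_apply, Finset.mul_sum]
  symm
  refine Finset.sum_of_injOn (fun τ => τ.extendDomain (someProdEquiv ι))
    (Equiv.Perm.extendDomainHom_injective (someProdEquiv ι)).injOn
    (fun _ _ => Finset.mem_coe.2 (Finset.mem_univ _)) ?_ ?_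
  · intro σ _ hσ
    split_ifs with h0
    · rcases h1 : σ (none, 1) with ⟨_ | k, s⟩
      · exfalso
        have hs : s = 1 := by
          by_contra hs
          have : s = 0 := by omega
          subst this
          simpa using σ.injective (h0.trans h1.symm)
        subst hs
        apply hσ
        have hfix : ∀ x : Option ι × Fin 2, ¬ x.1 ≠ none → σ x = x := by
          rintro ⟨x, s⟩ hx
          obtain rfl : x = none := by simpa using hx
          fin_cases s
          · exact h0
          · exact h1
        have hiff : ∀ x, (σ x).1 ≠ none ↔ x.1 ≠ none := by
          intro x
          refine ⟨fun h hx => h ?_, fun h hx => h ?_⟩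
          · rw [hfix x (by simpa using hx)]; exact hx
          · have := σ.injective (hfix (σ x) (by simpa using hx))
            rwa [this] at hx
        refine ⟨(someProdEquiv ι).symm.permCongr (σ.subtypePerm hiff), by simp, ?_⟩
        ext1 x
        beta_reduce
        by_cases hx : x.1 ≠ none
        · rw [Equiv.Perm.extendDomain_apply_subtype _ (someProdEquiv ι) hx]
          simp [Equiv.permCongr_apply]
        · rw [Equiv.Perm.extendDomain_apply_not_subtype _ (someProdEquiv ι) hx, hfix x hx]
      · rw [wedgeTerm, Fintype.prod_option, h0, h1, horth (k, s)]
        simp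
    · rfl
  · intro τ _
    have hn : ∀ s, τ.extendDomain (someProdEquiv ι) (none, s) = (none, s) := fun s =>
      Equiv.Perm.extendDomain_apply_not_subtype _ _ (by simp)
    have hs : ∀ k s, τ.extendDomain (someProdEquiv ι) (some k, s) =
        (some (τ (k, s)).1, (τ (k, s)).2) := fun k s =>
      Equiv.Perm.extendDomain_apply_image τ (someProdEquiv ι) (k, s)
    rw [if_pos (hn 0)]
    simp only [wedgeTerm, Equiv.Perm.sign_extendDomain, Fintype.prod_option, hn, hs]
    ring

theorem wedgePow_eq_zero_of_orthogonal (B : V →ₗ[ℝ] V →ₗ[ℝ] ℝ) (hB : B.IsAlt)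
    (v : ι × Fin 2 → V) (j : ι × Fin 2) (h : ∀ k, B (v j) (v k) = 0) : wedgePow ι B v = 0 := by
  rw [wedgePow_apply]
  refine Finset.sum_eq_zero fun σ _ => ?_
  rw [wedgeTerm, Finset.prod_eq_zero (Finset.mem_univ (σ.symm j).1), mul_zero]
  rcases hx : σ.symm j with ⟨l, s⟩
  have hj : σ (l, s) = j := by rw [← hx, Equiv.apply_symm_apply]
  fin_cases s
  · exact (congrArg (fun x => B (v x) _) hj).trans (h _)
  · refine hB.isRefl _ _ ?_
    exact (congrArg (fun x => B (v x) _) hj).trans (h _)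

end WedgePow

theorem exists_sub_orthogonal {V : Type*} [AddCommGroup V] [Module ℝ V] [FiniteDimensional ℝ V]
    (B : V →ₗ[ℝ] V →ₗ[ℝ] ℝ) (U : Submodule ℝ V) (hU : NondegOn (fun v w => B v w) U) (x : V) :
    ∃ u ∈ U, ∀ w ∈ U, B (x - u) w = 0 := by
  have hinj : Function.Injective (B.domRestrict₁₂ U U) := by
    refine (injective_iff_map_eq_zero _).2 fun u hu => Subtype.ext (hU u u.2 fun w hw => ?_)
    exact LinearMap.congr_fun hu ⟨w, hw⟩
  obtain ⟨u, hu⟩ := (LinearMap.injective_iff_surjective_of_finrank_eq_finrank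
    (Subspace.dual_finrank_eq (K := ℝ) (V := U)).symm).1 hinj ((B x).domRestrict U)
  refine ⟨u, u.2, fun w hw => ?_⟩
  have : B u w = B x w := LinearMap.congr_fun hu ⟨w, hw⟩
  simp [this]

/-- The vectors `e_j` (for `s = 0`) and `i·e_j` (for `s = 1`) of `ℂ^n`. -/
noncomputable def axisVec (n : ℕ) (j : Fin n) (s : Fin 2) : Fin n → ℂ :=
  Pi.single j (![1, Complex.I] s)

/-- The family of axis vectors of the coordinates in `S`. -/
noncomputable def axisFamily (n : ℕ) (S : Finset (Fin n)) (x : {j // j ∈ S} × Fin 2) :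
    Fin n → ℂ :=
  axisVec n x.1 x.2

theorem axisFamily_mem_coordSubspace (n : ℕ) (I : Finset (Fin n))
    (x : {j // j ∈ Iᶜ} × Fin 2) : axisFamily n Iᶜ x ∈ coordSubspace n I := by
  intro j hj
  have hx : j ≠ x.1 := fun h => Finset.mem_compl.1 x.1.2 (h ▸ hj)
  simp [axisFamily, axisVec, hx]

theorem eq_sum_axisFamily (n : ℕ) (I : Finset (Fin n)) {u : Fin n → ℂ}
    (hu : u ∈ coordSubspace n I) :
    u = ∑ x : {j // j ∈ Iᶜ} × Fin 2, (![(u x.1).re, (u x.1).im] x.2) • axisFamily n Iᶜ x := by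
  ext k
  simp only [Fintype.sum_prod_type, Fin.sum_univ_two, Finset.sum_apply,
    Pi.smul_apply, axisFamily, axisVec]
  by_cases hk : k ∈ I
  · rw [hu k hk, Finset.sum_eq_zero]
    intro x _
    have hx : k ≠ x := fun h => Finset.mem_compl.1 x.2 (h ▸ hk)
    simp [hx]
  · rw [Fintype.sum_eq_single ⟨k, Finset.mem_compl.2 hk⟩]
    · simp
    · intro x hx
      have hx : k ≠ x := fun h => hx (Subtype.ext h.symm)
      simp [hx]

theorem coordSubspace_le_span (n : ℕ) (I : Finset (Fin n)) :
    coordSubspace n I ≤ Submodule.span ℝ (Set.range (axisFamily n Iᶜ)) := by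
  intro u hu
  rw [eq_sum_axisFamily n I hu]
  exact Submodule.sum_mem _ fun x _ =>
    Submodule.smul_mem _ _ (Submodule.subset_span (Set.mem_range_self x))

theorem nondegOn_coordSubspace {n : ℕ} (B : (Fin n → ℂ) →ₗ[ℝ] (Fin n → ℂ) →ₗ[ℝ] ℝ)
    (hB : B.IsAlt) (I : Finset (Fin n))
    (hI : wedgePow {j // j ∈ Iᶜ} B (axisFamily n Iᶜ) ≠ 0) :
    NondegOn (fun v w => B v w) (coordSubspace n I) := by
  intro u hu horth
  rw [eq_sum_axisFamily n I hu]
  refine Finset.sum_eq_zero fun x _ => ?_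
  have hzero : wedgePow _ B (Function.update (axisFamily n Iᶜ) x u) = 0 := by
    refine wedgePow_eq_zero_of_orthogonal B hB _ x fun k => ?_
    rw [Function.update_self]
    by_cases hk : k = x
    · subst hk
      rw [Function.update_self]
      exact hB u
    · rw [Function.update_of_ne hk]
      exact horth _ (axisFamily_mem_coordSubspace n I k)
  rw [eq_sum_axisFamily n I hu, AlternatingMap.map_update_sum, Fintype.sum_eq_single x,
    AlternatingMap.map_update_smul, Function.update_eq_self, smul_eq_zero,
    or_iff_left hI] at hzero
  · rw [hzero, zero_smul]
  · intro y hy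
    rw [AlternatingMap.map_update_smul, AlternatingMap.map_update_self _ _ hy.symm, smul_zero]

/-- The position of the vectors of the `l`-th pair in a `2m`-tuple. -/
def pairIndex (m : ℕ) : Fin m × Fin 2 ≃ Fin (2 * m) :=
  finProdFinEquiv.trans (finCongr (mul_comm m 2))

theorem formPow_eq_wedgePow {V : Type*} [AddCommGroup V] [Module ℝ V]
    (B : V →ₗ[ℝ] V →ₗ[ℝ] ℝ) (m : ℕ) (v : Fin (2 * m) → V) :
    formPow (fun v w => B v w) m v = wedgePow (Fin m) B (fun x => v (pairIndex m x)) := by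
  rw [wedgePow_apply, formPow]
  symm
  refine Fintype.sum_equiv (pairIndex m).permCongr _ _ fun σ => ?_
  simp only [wedgeTerm, Equiv.Perm.sign_permCongr]
  congr 1
  refine Finset.prod_congr rfl fun l _ => ?_
  have h0 : (⟨2 * (l : ℕ), by omega⟩ : Fin (2 * m)) = pairIndex m (l, 0) := by
    ext; simp [pairIndex]
  have h1 : (⟨2 * (l : ℕ) + 1, by omega⟩ : Fin (2 * m)) = pairIndex m (l, 1) := by
    ext; simp [pairIndex, add_comm]
  simp only [h0, h1, Equiv.permCongr_apply, Equiv.symm_apply_apply]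

theorem formPow_stdTuple {n : ℕ} (B : (Fin n → ℂ) →ₗ[ℝ] (Fin n → ℂ) →ₗ[ℝ] ℝ)
    (I : Finset (Fin n)) :
    formPow (fun v w => B v w) (n - I.card) (stdTuple n I) =
      wedgePow {j // j ∈ Iᶜ} B (axisFamily n Iᶜ) := by
  rw [formPow_eq_wedgePow, ← wedgePow_reindex B
    (Iᶜ.orderIsoOfFin (by simp [Finset.card_compl] : Iᶜ.card = n - I.card)).toEquiv]
  congr 1
  funext ⟨l, s⟩
  have hdiv : (⟨(pairIndex _ (l, s) : ℕ) / 2, by omega⟩ : Fin (n - I.card)) = l := by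
    ext; simp [pairIndex]; omega
  have hmod : (pairIndex _ (l, s) : ℕ) % 2 = s := by
    simp [pairIndex]; omega
  simp only [stdTuple, hdiv, hmod, axisFamily, axisVec]
  fin_cases s <;> simp

theorem areaForm_apply (n : ℕ) (i : Fin n) (v w : Fin n → ℂ) :
    areaForm n i v w = (v i).re * (w i).im - (v i).im * (w i).re := rfl

theorem pos_of_orthogonal_axisVec_sub {n : ℕ} (B : (Fin n → ℂ) →ₗ[ℝ] (Fin n → ℂ) →ₗ[ℝ] ℝ)
    (hB : B.IsAlt) (i : Fin n) (I : Finset (Fin n)) (hi : i ∉ I)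
    (hI : 0 < wedgePow {j // j ∈ Iᶜ} B (axisFamily n Iᶜ))
    (hiI : 0 < wedgePow {j // j ∈ (insert i I)ᶜ} B (axisFamily n (insert i I)ᶜ))
    {x y : Fin n → ℂ} (hx : x ∈ coordSubspace n (insert i I))
    (hy : y ∈ coordSubspace n (insert i I))
    (horth : ∀ w ∈ coordSubspace n (insert i I), B (axisVec n i 0 - x) w = 0) :
    0 < B (axisVec n i 0 - x) (axisVec n i 1 - y) := by
  set J := (insert i I)ᶜ with hJ
  have hiJ : i ∉ J := by simp [hJ]
  have hins : ∀ k, k ∈ insert i J ↔ k ∈ Iᶜ := by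
    intro k
    by_cases hk : k = i
    · simp [hk, hi]
    · simp [hJ, hk]
  let e : Option {j // j ∈ J} ≃ {j // j ∈ Iᶜ} :=
    (Finset.subtypeInsertEquivOption hiJ).symm.trans (Equiv.subtypeEquivRight hins)
  let v : Option {j // j ∈ J} × Fin 2 → Fin n → ℂ := fun p => axisFamily n Iᶜ (e p.1, p.2)
  have hnone : ∀ s, v (none, s) = axisVec n i s := fun s => rfl
  have hsome : ∀ p : {j // j ∈ J} × Fin 2, v (some p.1, p.2) = axisFamily n J p := fun p => rfl
  let v₁ := Function.update v (none, 0) (axisVec n i 0 - x)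
  let v₂ := Function.update v₁ (none, 1) (axisVec n i 1 - y)
  have hspan : ∀ (t : Option {j // j ∈ J} × Fin 2 → Fin n → ℂ) (s : Fin 2),
      (∀ p : {j // j ∈ J} × Fin 2, t (some p.1, p.2) = axisFamily n J p) →
      ∀ u ∈ coordSubspace n (insert i I), u ∈ Submodule.span ℝ (t '' {(none, s)}ᶜ) := by
    intro t s ht u hu
    refine Submodule.span_mono ?_ (coordSubspace_le_span n _ hu)
    rintro _ ⟨p, rfl⟩
    exact ⟨(some p.1, p.2), by simp, ht p⟩
  have hv₁some : ∀ p : {j // j ∈ J} × Fin 2, v₁ (some p.1, p.2) = axisFamily n J p := by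
    intro p
    simp [v₁, hsome]
  have hv₁ : wedgePow _ B v₁ = wedgePow _ B v := by
    simp only [v₁]
    rw [AlternatingMap.map_update_sub,
      AlternatingMap.map_update_eq_zero_of_mem_span _ _ _ (hspan v 0 hsome x hx), sub_zero,
      ← hnone, Function.update_eq_self]
  have hv₁one : v₁ (none, 1) = axisVec n i 1 := by
    simp [v₁, hnone]
  have hv₂ : wedgePow _ B v₂ = wedgePow _ B v₁ := by
    simp only [v₂]
    rw [AlternatingMap.map_update_sub,
      AlternatingMap.map_update_eq_zero_of_mem_span _ _ _ (hspan v₁ 1 hv₁some y hy), sub_zero,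
      ← hv₁one, Function.update_eq_self]
  have hv₂some : ∀ p : {j // j ∈ J} × Fin 2, v₂ (some p.1, p.2) = axisFamily n J p := by
    intro p
    simp [v₂, hv₁some]
  have hv₂zero : v₂ (none, 0) = axisVec n i 0 - x := by
    simp [v₂, v₁]
  have hv₂one : v₂ (none, 1) = axisVec n i 1 - y := by
    simp [v₂]
  have hpos : 0 < wedgePow _ B v₂ := by
    rw [hv₂, hv₁, wedgePow_reindex B e]
    exact hI
  rw [wedgePow_option_of_orthogonal B hB v₂ (fun p => by
    rw [hv₂zero, hv₂some]
    exact horth _ (axisFamily_mem_coordSubspace n _ p))] at hpos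
  simp only [hv₂zero, hv₂one, hv₂some] at hpos
  exact pos_of_mul_pos_left (pos_of_mul_pos_right hpos (by positivity)) hiI.le

/-- geometric content of the proof of Lemma 3.2: let `Ω` be a
nondegenerate alternating 2-form on `ℂ^n` whose restriction to every coordinate subspace
`ℂ^n_I` is nondegenerate with orientation agreeing with the complex orientation (encoded:
the top power of `Ω` on the standard complex-positively-oriented basis of `ℂ^n_I` is
positive), and let `i ∉ I`.  Then the `Ω`-orthogonal complement
`W = (ℂ^n_{I∪{i}})^Ω ∩ ℂ^n_I` of `ℂ^n_{I∪{i}}` in `ℂ^n_I` is 2-dimensional, the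
restriction of `dx_i∧dy_i` to `W` is nondegenerate, and the `Ω`-orientation of `W`
agrees with the orientation induced by `dx_i∧dy_i|_W`. -/
theorem stmt17 (n : ℕ) (B : (Fin n → ℂ) →ₗ[ℝ] (Fin n → ℂ) →ₗ[ℝ] ℝ)
    (halt : ∀ v, B v v = 0)
    (hnd : ∀ v, (∀ w, B v w = 0) → v = 0)
    (hpos : ∀ I : Finset (Fin n),
      0 < formPow (fun v w => B v w) (n - I.card) (stdTuple n I))
    (i : Fin n) (I : Finset (Fin n)) (hi : i ∉ I) :
    Module.finrank ℝ
        (sympCompl B (coordSubspace n (insert i I)) ⊓ coordSubspace n I : Submodule ℝ _) = 2 ∧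
    NondegOn (fun v w => areaForm n i v w)
        (sympCompl B (coordSubspace n (insert i I)) ⊓ coordSubspace n I) ∧
    (∀ v w : Fin n → ℂ,
      v ∈ sympCompl B (coordSubspace n (insert i I)) ⊓ coordSubspace n I →
      w ∈ sympCompl B (coordSubspace n (insert i I)) ⊓ coordSubspace n I →
      Submodule.span ℝ ({v, w} : Set (Fin n → ℂ)) =
        sympCompl B (coordSubspace n (insert i I)) ⊓ coordSubspace n I →
      0 < B v w * areaForm n i v w) := by
  have hB : B.IsAlt := halt
  have hwedge : ∀ I : Finset (Fin n), 0 < wedgePow {j // j ∈ Iᶜ} B (axisFamily n Iᶜ) :=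
    fun I => formPow_stdTuple B I ▸ hpos I
  have hU := nondegOn_coordSubspace B hB (insert i I) (hwedge _).ne'
  obtain ⟨x, hx, hxo⟩ := exists_sub_orthogonal B _ hU (axisVec n i 0)
  obtain ⟨y, hy, hyo⟩ := exists_sub_orthogonal B _ hU (axisVec n i 1)
  have hef := pos_of_orthogonal_axisVec_sub B hB i I hi (hwedge I) (hwedge _) hx hy hxo
  set W := sympCompl B (coordSubspace n (insert i I)) ⊓ coordSubspace n I with hW
  have haxis : ∀ s, ∀ u ∈ coordSubspace n (insert i I),
      axisVec n i s - u ∈ coordSubspace n I := by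
    intro s u hu j hj
    have hji : j ≠ i := fun h => hi (h ▸ hj)
    simp [axisVec, hji, hu j (Finset.mem_insert_of_mem hj)]
  set e := axisVec n i 0 - x with he
  set f := axisVec n i 1 - y with hf
  have heW : e ∈ W := ⟨hxo, haxis 0 x hx⟩
  have hfW : f ∈ W := ⟨hyo, haxis 1 y hy⟩
  have hei : e i = 1 := by
    simp [he, axisVec, hx i (Finset.mem_insert_self i I)]
  have hfi : f i = Complex.I := by
    simp [hf, axisVec, hy i (Finset.mem_insert_self i I)]
  have hinj : ∀ v ∈ W, v i = 0 → v = 0 := by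
    intro v hv hvi
    refine hU v ?_ hv.1
    intro j hj
    rcases Finset.mem_insert.1 hj with rfl | hj
    · exact hvi
    · exact hv.2 j hj
  have hdecomp : ∀ v ∈ W, v = (v i).re • e + (v i).im • f := by
    intro v hv
    refine sub_eq_zero.1 (hinj _ (W.sub_mem hv (W.add_mem (W.smul_mem _ heW)
      (W.smul_mem _ hfW))) ?_)
    simp [hei, hfi]
  have hBarea : ∀ v ∈ W, ∀ w ∈ W, B v w = areaForm n i v w * B e f := by
    intro v hv w hw
    conv_lhs => rw [hdecomp v hv, hdecomp w hw]
    simp only [map_add, map_smul, LinearMap.add_apply, LinearMap.smul_apply, smul_eq_mul,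
      hB e, hB f, ← hB.neg e f, areaForm_apply]
    ring
  refine ⟨?_, ?_, ?_⟩
  · have hbij : Function.Bijective
        ((LinearMap.proj (R := ℝ) (φ := fun _ : Fin n => ℂ) i).domRestrict W) := by
      refine ⟨(injective_iff_map_eq_zero _).2 fun v hv => Subtype.ext (hinj v v.2 hv),
        fun z => ⟨⟨z.re • e + z.im • f, W.add_mem (W.smul_mem _ heW) (W.smul_mem _ hfW)⟩, ?_⟩⟩
      simp [hei, hfi]
    rw [(LinearEquiv.ofBijective _ hbij).finrank_eq, Complex.finrank_real_complex]
  · intro v hv hvw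
    have h1 := hvw e heW
    have h2 := hvw f hfW
    simp only [areaForm_apply, hei, hfi] at h1 h2
    exact hinj v hv (Complex.ext (by simpa using h2) (by simpa using h1))
  · intro v w hv hw hspan
    rw [hBarea v hv w hw]
    have hne : areaForm n i v w ≠ 0 := by
      intro h0
      obtain ⟨a, b, hab⟩ := Submodule.mem_span_pair.1 (hspan ▸ heW)
      obtain ⟨c, d, hcd⟩ := Submodule.mem_span_pair.1 (hspan ▸ hfW)
      have hv0 : B v w = 0 := by rw [hBarea v hv w hw, h0, zero_mul]
      have : B e f = 0 := by
        rw [← hab, ← hcd]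
        simp [hB v, hB w, ← hB.neg v w, hv0]
      exact hef.ne' this
    have := mul_pos (mul_self_pos.2 hne) hef
    linarith
end
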